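/- arXiv:2207.08128 — 2 statements merged into one kernel-verified Lean document; each statement's English description precedes it below -/
import Mathlib

section
/- Let f(x) = ½‖A x^{m−1} − b‖², let x* ∈ ℝⁿ and δ₁ > 0, and set R = ‖x*‖ + δ₁ and M = (m−1)(2m−3)·‖A‖_F²·R^{2m−4} + (m−1)(m−2)·‖b‖·‖A‖_F·R^{m−3}. Then for every x ∈ ℝⁿ with ‖x − x*‖ ≤ δ₁ and every y ∈ ℝⁿ, ⟨y, ∇²f(x) y⟩ ≤ M·‖y‖²; equivalently the spectral norm of ∇²f(x) is at most M. -/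
open scoped BigOperators RealInnerProductSpace

noncomputable section

/-- Contraction of an order-`m` tensor `A` on `{1,…,n}` with `m - d` copies of the vector `x`,
yielding an order-`d` tensor: the first `d` indices are free, the last `m - d` are summed
against copies of `x`. -/
def contra (m n : ℕ) (A : (Fin m → Fin n) → ℝ) (x : EuclideanSpace ℝ (Fin n))
    (d : ℕ) (hd : d ≤ m) : (Fin d → Fin n) → ℝ :=
  fun i => ∑ j : Fin (m - d) → Fin n,
    A (fun k => Fin.append i j (Fin.cast (by omega) k)) * ∏ l, x (j l)

/-- `A x^{m-1}` as a vector in `ℝⁿ`. -/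
def tvec (m n : ℕ) (A : (Fin m → Fin n) → ℝ) (x : EuclideanSpace ℝ (Fin n))
    (h : 1 ≤ m) : EuclideanSpace ℝ (Fin n) :=
  (EuclideanSpace.equiv (Fin n) ℝ).symm fun i => contra m n A x 1 h ![i]

/-- `A x^{m-2}` as an `n × n` matrix. -/
def tmat (m n : ℕ) (A : (Fin m → Fin n) → ℝ) (x : EuclideanSpace ℝ (Fin n))
    (h : 2 ≤ m) : Matrix (Fin n) (Fin n) ℝ :=
  Matrix.of fun i j => contra m n A x 2 h ![i, j]

/-- The least-squares objective `f(x) = ½ ‖A x^{m-1} - b‖²`. -/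
def obj (m n : ℕ) (A : (Fin m → Fin n) → ℝ) (b : EuclideanSpace ℝ (Fin n))
    (h : 1 ≤ m) : EuclideanSpace ℝ (Fin n) → ℝ :=
  fun x => (1 / 2) * ‖tvec m n A x h - b‖ ^ 2

/-- Frobenius norm of a tensor (indexed family of reals). -/
def frob {ι : Type*} [Fintype ι] (T : ι → ℝ) : ℝ :=
  Real.sqrt (∑ i, T i ^ 2)

/-- Hessian matrix of `f` at `x` via the second iterated Fréchet derivative. -/
def hess (n : ℕ) (f : EuclideanSpace ℝ (Fin n) → ℝ) (x : EuclideanSpace ℝ (Fin n)) :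
    Matrix (Fin n) (Fin n) ℝ :=
  Matrix.of fun i j =>
    iteratedFDeriv ℝ 2 f x ![EuclideanSpace.single i 1, EuclideanSpace.single j 1]

/-- Support of a vector. -/
def supp {n : ℕ} (x : EuclideanSpace ℝ (Fin n)) : Finset (Fin n) :=
  Finset.univ.filter fun i => x i ≠ 0

/-- `ℓ₀`-"norm": number of nonzero entries. -/
def spars {n : ℕ} (x : EuclideanSpace ℝ (Fin n)) : ℕ := (supp x).card

/-- Principal submatrix indexed by a finite index set `T`. -/
def subMat {n : ℕ} (M : Matrix (Fin n) (Fin n) ℝ) (T : Finset (Fin n)) :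
    Matrix {i // i ∈ T} {i // i ∈ T} ℝ :=
  Matrix.of fun i j => M i.1 j.1

/-- Spectral norm of a (possibly rectangular) real matrix, i.e. the operator norm of the
induced map between Euclidean spaces. -/
def specNorm {α β : Type*} [Fintype α] [Fintype β] [DecidableEq β] (M : Matrix α β ℝ) : ℝ :=
  ‖LinearMap.toContinuousLinearMap (Matrix.toEuclideanLin M)‖

/-- Membership `z ∈ P_s(u)` for the hard-thresholding projection. -/
def inProj {n : ℕ} (s : ℕ) (u z : EuclideanSpace ℝ (Fin n)) : Prop :=
  spars z ≤ s ∧ ∀ w : EuclideanSpace ℝ (Fin n), spars w ≤ s → ‖u - z‖ ≤ ‖u - w‖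

/-- Membership `T ∈ 𝒯(x;η)`: `T` collects `s` indices of largest-magnitude entries of
`u = x - η ∇f(x)`. -/
def Tmem {n : ℕ} (f : EuclideanSpace ℝ (Fin n) → ℝ) (s : ℕ) (η : ℝ)
    (x : EuclideanSpace ℝ (Fin n)) (T : Finset (Fin n)) : Prop :=
  T.card = s ∧ ∀ i ∈ T, ∀ j ∉ T,
    |(x - η • gradient f x) j| ≤ |(x - η • gradient f x) i|

/-- The index of the tensor entry met by the free index `p.1` and the summed indices `p.2` in the
contraction with `m - 1` vectors. -/
def consIndex (m n : ℕ) (h : 1 ≤ m) (p : Fin n × (Fin (m - 1) → Fin n)) : Fin m → Fin n :=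
  fun k => Fin.append ![p.1] p.2 (Fin.cast (by omega) k)

lemma consIndex_injective (m n : ℕ) (h : 1 ≤ m) : Function.Injective (consIndex m n h) := by
  rintro ⟨i, j⟩ ⟨i', j'⟩ hp
  have key (k : Fin (1 + (m - 1))) : Fin.append ![i] j k = Fin.append ![i'] j' k := by
    exact congrFun hp (Fin.cast (by omega) k)
  refine Prod.ext ?_ (funext fun l => ?_)
  · simpa using key (Fin.castAdd _ 0)
  · simpa using key (Fin.natAdd 1 l)

lemma frob_nonneg {ι : Type*} [Fintype ι] (T : ι → ℝ) : 0 ≤ frob T := Real.sqrt_nonneg _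

lemma frob_sq {ι : Type*} [Fintype ι] (T : ι → ℝ) : frob T ^ 2 = ∑ i, T i ^ 2 :=
  Real.sq_sqrt (Finset.sum_nonneg fun _ _ => sq_nonneg _)

/-- The multilinear map `(v₁, …, v_{m-1}) ↦ A v₁ ⋯ v_{m-1}`. -/
def contraMultilinear (m n : ℕ) (A : (Fin m → Fin n) → ℝ) (h : 1 ≤ m) :
    ContinuousMultilinearMap ℝ (fun _ : Fin (m - 1) => EuclideanSpace ℝ (Fin n))
      (EuclideanSpace ℝ (Fin n)) :=
  ((EuclideanSpace.equiv (Fin n) ℝ).symm :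
      (Fin n → ℝ) →L[ℝ] EuclideanSpace ℝ (Fin n)).compContinuousMultilinearMap <|
    ContinuousMultilinearMap.pi fun i => ∑ j : Fin (m - 1) → Fin n,
      A (consIndex m n h (i, j)) •
        (ContinuousMultilinearMap.mkPiAlgebra ℝ (Fin (m - 1)) ℝ).compContinuousLinearMap
          fun l => EuclideanSpace.proj (j l)

lemma contraMultilinear_apply (m n : ℕ) (A : (Fin m → Fin n) → ℝ) (h : 1 ≤ m)
    (v : Fin (m - 1) → EuclideanSpace ℝ (Fin n)) (i : Fin n) :
    contraMultilinear m n A h v i =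
      ∑ j : Fin (m - 1) → Fin n, A (consIndex m n h (i, j)) * ∏ l, v l (j l) := by
  simp [contraMultilinear]

lemma tvec_eq_contraMultilinear (m n : ℕ) (A : (Fin m → Fin n) → ℝ)
    (x : EuclideanSpace ℝ (Fin n)) (h : 1 ≤ m) :
    tvec m n A x h = contraMultilinear m n A h fun _ => x := by
  ext i
  rw [contraMultilinear_apply]
  rfl

lemma norm_contraMultilinear_le (m n : ℕ) (A : (Fin m → Fin n) → ℝ) (h : 1 ≤ m) :
    ‖contraMultilinear m n A h‖ ≤ frob A := by
  refine ContinuousMultilinearMap.opNorm_le_bound (frob_nonneg A) fun v => ?_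
  have hv : ∏ l, ‖v l‖ ^ 2 = ∑ j : Fin (m - 1) → Fin n, (∏ l, v l (j l)) ^ 2 := by
    simp_rw [EuclideanSpace.real_norm_sq_eq, Finset.prod_univ_sum, Fintype.piFinset_univ,
      Finset.prod_pow]
  have hA : ∑ p, A (consIndex m n h p) ^ 2 ≤ ∑ i, A i ^ 2 := by
    classical
    rw [← Finset.sum_image (f := fun i => A i ^ 2) (consIndex_injective m n h).injOn]
    exact Finset.sum_le_univ_sum_of_nonneg fun _ => sq_nonneg _
  have h : ‖contraMultilinear m n A h v‖ ^ 2 ≤ (frob A * ∏ l, ‖v l‖) ^ 2 := by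
    rw [EuclideanSpace.real_norm_sq_eq, mul_pow, frob_sq, ← Finset.prod_pow, hv]
    calc
      _ ≤ ∑ i, (∑ j, A (consIndex m n h (i, j)) ^ 2) *
            ∑ j : Fin (m - 1) → Fin n, (∏ l, v l (j l)) ^ 2 := by
        refine Finset.sum_le_sum fun i _ => ?_
        rw [contraMultilinear_apply]
        exact Finset.sum_mul_sq_le_sq_mul_sq _ _ _
      _ ≤ _ := by
        rw [← Finset.sum_mul, ← Fintype.sum_prod_type' fun i j => A (consIndex m n h (i, j)) ^ 2]
        gcongr
  have := frob_nonneg A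
  exact (sq_le_sq₀ (norm_nonneg _) (by positivity)).1 h

section Diagonal

variable {ι E F : Type*} [Fintype ι] [NormedAddCommGroup E] [NormedSpace ℝ E]
  [NormedAddCommGroup F]

lemma ContinuousMultilinearMap.contDiff_diagonal [NormedSpace ℝ F]
    (G : ContinuousMultilinearMap ℝ (fun _ : ι => E) F) {N : WithTop ℕ∞} :
    ContDiff ℝ N fun x => G fun _ => x :=
  G.contDiff.comp (contDiff_pi.2 fun _ => contDiff_id)

lemma ContinuousMultilinearMap.norm_iteratedFDeriv_diagonal_le [NormedSpace ℝ F]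
    (G : ContinuousMultilinearMap ℝ (fun _ : ι => E) F) (d : ℕ) (x : E) :
    ‖iteratedFDeriv ℝ d (fun x => G fun _ => x) x‖ ≤
      (Fintype.card ι).descFactorial d * ‖G‖ * ‖x‖ ^ (Fintype.card ι - d) := by
  let L : E →L[ℝ] ι → E := ContinuousLinearMap.pi fun _ => ContinuousLinearMap.id ℝ E
  have hL : ‖L‖ ≤ 1 :=
    ContinuousLinearMap.norm_pi_le_of_le (fun _ => ContinuousLinearMap.norm_id_le) zero_le_one
  have hLx : ‖L x‖ ≤ ‖x‖ := by simpa using L.le_of_opNorm_le hL x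
  have hcomp : (fun x => G fun _ => x) = G ∘ L := rfl
  rw [hcomp, L.iteratedFDeriv_comp_right (G.contDiff (n := d)) x le_rfl]
  calc
    _ ≤ ‖iteratedFDeriv ℝ d G (L x)‖ * ∏ _ : Fin d, ‖L‖ :=
      ContinuousMultilinearMap.norm_compContinuousLinearMap_le _ _
    _ ≤ ‖iteratedFDeriv ℝ d G (L x)‖ * 1 := by
      gcongr
      exact Finset.prod_le_one (fun _ _ => norm_nonneg _) fun _ _ => hL
    _ ≤ _ := by
      rw [mul_one]
      refine (G.norm_iteratedFDeriv_le d (L x)).trans ?_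
      gcongr

lemma norm_iteratedFDeriv_two_half_norm_sq_le [InnerProductSpace ℝ F] {H : E → F}
    (hH : ContDiff ℝ 2 H) (x : E) :
    ‖iteratedFDeriv ℝ 2 (fun z => (1 / 2 : ℝ) * ‖H z‖ ^ 2) x‖ ≤
      ‖iteratedFDeriv ℝ 1 H x‖ ^ 2 + ‖H x‖ * ‖iteratedFDeriv ℝ 2 H x‖ := by
  have heq : (fun z => (1 / 2 : ℝ) * ‖H z‖ ^ 2) =
      fun z => (1 / 2 : ℝ) • innerSL ℝ (H z) (H z) := by
    ext z
    simp
  have hb := (innerSL ℝ (E := F)).norm_iteratedFDeriv_le_of_bilinear_of_le_one hH hH x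
    (n := 2) le_rfl (norm_innerSL_le ℝ)
  have hc : ContDiff ℝ 2 fun z => innerSL ℝ (H z) (H z) := by
    simpa using hH.inner ℝ hH
  rw [heq, iteratedFDeriv_const_smul_apply' hc.contDiffAt, norm_smul]
  simp only [Finset.sum_range_succ, Finset.sum_range_zero, zero_add] at hb
  change _ ≤ (1 : ℕ) * ‖iteratedFDeriv ℝ 0 H x‖ * ‖iteratedFDeriv ℝ 2 H x‖ +
    (2 : ℕ) * ‖iteratedFDeriv ℝ 1 H x‖ * ‖iteratedFDeriv ℝ 1 H x‖ +
    (1 : ℕ) * ‖iteratedFDeriv ℝ 2 H x‖ * ‖iteratedFDeriv ℝ 0 H x‖ at hb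
  rw [norm_iteratedFDeriv_zero] at hb
  rw [Real.norm_of_nonneg (by norm_num)]
  push_cast at hb
  linarith

end Diagonal

lemma sum_hess_mul (n : ℕ) (f : EuclideanSpace ℝ (Fin n) → ℝ) (x y : EuclideanSpace ℝ (Fin n)) :
    ∑ i, ∑ j, y i * hess n f x i j * y j = iteratedFDeriv ℝ 2 f x ![y, y] := by
  have hy : y = ∑ i, y i • EuclideanSpace.single i (1 : ℝ) := by
    simpa using ((EuclideanSpace.basisFun (Fin n) ℝ).sum_repr y).symm
  conv_rhs => rw [iteratedFDeriv_two_apply]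
  simp only [Matrix.cons_val_zero, Matrix.cons_val_one]
  conv_rhs => rw [hy]
  simp only [map_sum, map_smul, hess, Matrix.of_apply, iteratedFDeriv_two_apply,
    Matrix.cons_val_zero, Matrix.cons_val_one, sum_apply,
    smul_apply, smul_eq_mul, Finset.mul_sum]
  rw [Finset.sum_comm]
  exact Finset.sum_congr rfl fun i _ => Finset.sum_congr rfl fun j _ => by ring

/-- strong smoothness bound: for `‖x - x*‖ ≤ δ₁` and every `y`,
`⟨y, ∇²f(x) y⟩ ≤ M ‖y‖²` with
`M = (m-1)(2m-3)‖A‖_F² R^{2m-4} + (m-1)(m-2)‖b‖‖A‖_F R^{m-3}`, `R = ‖x*‖ + δ₁`. -/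
theorem strongly_smooth (m n : ℕ) (hm : 3 ≤ m) (hn : 1 ≤ n)
    (A : (Fin m → Fin n) → ℝ)
    (hA : ∀ (σ : Equiv.Perm (Fin m)) (i : Fin m → Fin n), A (i ∘ σ) = A i)
    (b : EuclideanSpace ℝ (Fin n))
    (xs : EuclideanSpace ℝ (Fin n)) (δ₁ : ℝ) (hδ₁ : 0 < δ₁) :
    ∀ x : EuclideanSpace ℝ (Fin n), ‖x - xs‖ ≤ δ₁ →
      ∀ y : EuclideanSpace ℝ (Fin n),
        ∑ i : Fin n, ∑ j : Fin n, y i * hess n (obj m n A b (by omega)) x i j * y j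
          ≤ (((m : ℝ) - 1) * (2 * (m : ℝ) - 3) * frob A ^ 2 * (‖xs‖ + δ₁) ^ (2 * m - 4)
              + ((m : ℝ) - 1) * ((m : ℝ) - 2) * ‖b‖ * frob A * (‖xs‖ + δ₁) ^ (m - 3))
            * ‖y‖ ^ 2 := by
  intro x hx y
  set G := contraMultilinear m n A (by omega)
  set R := ‖xs‖ + δ₁
  set a := frob A
  have ha : 0 ≤ a := frob_nonneg A
  have hR : 0 ≤ R := by positivity
  have hxR : ‖x‖ ≤ R := by linarith [norm_le_norm_add_norm_sub' x xs]
  have hm1 : ((m - 1 : ℕ) : ℝ) = m - 1 := by push_cast [show 1 ≤ m by omega]; ring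
  have hm2 : ((m - 2 : ℕ) : ℝ) = m - 2 := by push_cast [show 2 ≤ m by omega]; ring
  have hD (d : ℕ) : ‖iteratedFDeriv ℝ d (fun z => G fun _ => z) x‖ ≤
      (m - 1).descFactorial d * a * R ^ (m - 1 - d) := by
    refine (G.norm_iteratedFDeriv_diagonal_le d x).trans ?_
    rw [Fintype.card_fin]
    gcongr
    exact norm_contraMultilinear_le m n A _
  have hG : ContDiff ℝ 2 fun z => G fun _ => z := G.contDiff_diagonal
  have hsub (d : ℕ) (hd : d ≠ 0) (hd2 : d ≤ 2) :
      iteratedFDeriv ℝ d (fun z => (G fun _ => z) - b) x =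
        iteratedFDeriv ℝ d (fun z => G fun _ => z) x := by
    rw [fun_iteratedFDeriv_sub_apply (hG.of_le (by exact_mod_cast hd2)).contDiffAt
      contDiff_const.contDiffAt, iteratedFDeriv_const_of_ne hd]
    simp
  have h0 := hD 0
  have h1 := hD 1
  have h2 := hD 2
  rw [norm_iteratedFDeriv_zero] at h0
  rw [show m - 1 - 1 = m - 2 by omega] at h1
  rw [show m - 1 - 2 = m - 3 by omega] at h2
  simp only [Nat.descFactorial_succ, Nat.descFactorial_zero, Nat.sub_zero, mul_one, Nat.cast_mul,
    Nat.cast_one, one_mul, show m - 1 - 1 = m - 2 by omega, hm1, hm2] at h0 h1 h2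
  have hobj : obj m n A b (by omega) = fun z => (1 / 2 : ℝ) * ‖(G fun _ => z) - b‖ ^ 2 := by
    ext z
    rw [obj, tvec_eq_contraMultilinear]
  have hess_le := norm_iteratedFDeriv_two_half_norm_sq_le (hG.sub (contDiff_const (c := b))) x
  rw [hsub 1 (by norm_num) (by norm_num), hsub 2 (by norm_num) le_rfl, ← hobj] at hess_le
  have hbound : ‖iteratedFDeriv ℝ 2 (obj m n A b (by omega)) x‖ ≤
      ((m : ℝ) - 1) * (2 * m - 3) * a ^ 2 * R ^ (2 * m - 4) +
        ((m : ℝ) - 1) * (m - 2) * ‖b‖ * a * R ^ (m - 3) := by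
    calc
      _ ≤ (((m : ℝ) - 1) * a * R ^ (m - 2)) ^ 2 +
          (a * R ^ (m - 1) + ‖b‖) * (((m : ℝ) - 2) * (m - 1) * a * R ^ (m - 3)) := by
        refine hess_le.trans ?_
        gcongr
        exact (norm_sub_le _ _).trans (by gcongr)
      _ = _ := by
        obtain ⟨k, rfl⟩ := Nat.exists_eq_add_of_le' hm
        simp only [show k + 3 - 2 = k + 1 by omega, show k + 3 - 1 = k + 2 by omega,
          show k + 3 - 3 = k by omega, show 2 * (k + 3) - 4 = 2 * k + 2 by omega]
        push_cast
        ring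
  rw [sum_hess_mul]
  calc
    _ ≤ ‖iteratedFDeriv ℝ 2 (obj m n A b (by omega)) x ![y, y]‖ := Real.le_norm_self _
    _ ≤ ‖iteratedFDeriv ℝ 2 (obj m n A b (by omega)) x‖ * ‖y‖ ^ 2 := by
      refine (ContinuousMultilinearMap.le_opNorm _ _).trans_eq ?_
      simp [Fin.prod_univ_two, sq]
    _ ≤ _ := by gcongr
end
end

section
/- Let f(x) = ½‖A x^{m−1} − b‖² and s ∈ {1,…,n−1}. Let x ∈ ℝⁿ with ‖x‖₀ ≤ s, let η > 0, and let T ∈ T(x;η). Suppose there are constants 0 < m₀ ≤ M₀ such that m₀‖y‖² ≤ ⟨y, ∇²f(x) y⟩ ≤ M₀‖y‖² for every y ∈ ℝⁿ with |supp(y) ∪ supp(x) ∪ T| ≤ 2s. Let 0 < γ ≤ m₀ and 0 < η ≤ 1/(4M₀). Define the Newton direction d ∈ ℝⁿ by ∇²_T f(x)·d_T = ∇²_{T,T^c} f(x)·x_{T^c} − ∇_T f(x) and d_{T^c} = −x_{T^c}. Then ⟨∇_T f(x), d_T⟩ ≤ −γ‖d‖² + (1/(4η))‖x_{T^c}‖².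 -/
open scoped BigOperators RealInnerProductSpace

noncomputable section

theorem contDiff_obj (m n : ℕ) (A : (Fin m → Fin n) → ℝ) (b : EuclideanSpace ℝ (Fin n))
    (h : 1 ≤ m) : ContDiff ℝ 2 (obj m n A b h) := by
  have hvec : ContDiff ℝ 2 fun x => tvec m n A x h := by
    rw [contDiff_euclidean]
    intro i
    simp only [tvec, contra, EuclideanSpace.equiv, PiLp.coe_symm_continuousLinearEquiv]
    fun_prop
  exact contDiff_const.mul ((hvec.sub contDiff_const).norm_sq ℝ)

theorem hess_symm {n : ℕ} {f : EuclideanSpace ℝ (Fin n) → ℝ} (hf : ContDiff ℝ 2 f)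
    (x : EuclideanSpace ℝ (Fin n)) (i j : Fin n) : hess n f x i j = hess n f x j i := by
  have hsymm : IsSymmSndFDerivAt ℝ f x :=
    hf.contDiffAt.isSymmSndFDerivAt (by simp)
  simpa [hess, iteratedFDeriv_two_apply] using hsymm.eq _ _

/-- The vector agreeing with `d` on `T` and vanishing elsewhere. -/
def restrict {n : ℕ} (T : Finset (Fin n)) (d : EuclideanSpace ℝ (Fin n)) :
    EuclideanSpace ℝ (Fin n) :=
  WithLp.toLp 2 fun i => if i ∈ T then d i else 0

theorem restrict_apply {n : ℕ} (T : Finset (Fin n)) (d : EuclideanSpace ℝ (Fin n))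
    (i : Fin n) : restrict T d i = if i ∈ T then d i else 0 := rfl

theorem restrict_add_restrict_compl {n : ℕ} (T : Finset (Fin n))
    (d : EuclideanSpace ℝ (Fin n)) : restrict T d + restrict Tᶜ d = d := by
  ext i
  by_cases hi : i ∈ T <;> simp [restrict_apply, hi]

theorem norm_restrict_sq {n : ℕ} (T : Finset (Fin n)) (d : EuclideanSpace ℝ (Fin n)) :
    ‖restrict T d‖ ^ 2 = ∑ i ∈ T, d i ^ 2 := by
  simp [EuclideanSpace.real_norm_sq_eq, restrict_apply, ite_pow, Finset.sum_ite_mem]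

/-- For a symmetric form `H`, polarization expresses the pairing of `d_T` with `H d`. -/
theorem two_mul_sum_restrict {n : ℕ} {H : Matrix (Fin n) (Fin n) ℝ}
    (hH : ∀ i j, H i j = H j i) (T : Finset (Fin n)) (d : EuclideanSpace ℝ (Fin n)) :
    2 * ∑ i ∈ T, d i * ∑ j, H i j * d j =
      (∑ i, ∑ j, d i * H i j * d j)
        + (∑ i, ∑ j, restrict T d i * H i j * restrict T d j)
        - ∑ i, ∑ j, restrict Tᶜ d i * H i j * restrict Tᶜ d j := by
  have hleft : ∑ i ∈ T, d i * ∑ j, H i j * d j =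
      ∑ i, ∑ j, restrict T d i * H i j * d j := by
    simp [restrict_apply, Finset.mul_sum, mul_assoc]
  have hswap : ∑ i, ∑ j, restrict T d i * H i j * d j =
      ∑ i, ∑ j, d i * H i j * restrict T d j := by
    rw [Finset.sum_comm]
    refine Finset.sum_congr rfl fun i _ => Finset.sum_congr rfl fun j _ => ?_
    rw [hH j i]
    ring
  rw [two_mul, hleft]
  nth_rewrite 2 [hswap]
  simp only [← Finset.sum_add_distrib, ← Finset.sum_sub_distrib]
  refine Finset.sum_congr rfl fun i _ => Finset.sum_congr rfl fun j _ => ?_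
  have hi : restrict Tᶜ d i = d i - restrict T d i := by
    by_cases h : i ∈ T <;> simp [restrict_apply, h]
  have hj : restrict Tᶜ d j = d j - restrict T d j := by
    by_cases h : j ∈ T <;> simp [restrict_apply, h]
  rw [hi, hj]
  ring

/-- descent property of the restricted Newton direction: under restricted
strong convexity/smoothness constants `m₀ ≤ M₀` at `x`, with `0 < γ ≤ m₀` and
`0 < η ≤ 1/(4M₀)`, the Newton direction `d` satisfies
`⟨∇_T f(x), d_T⟩ ≤ -γ‖d‖² + (1/(4η))‖x_{T^c}‖²`. -/
theorem newton_descent (m n : ℕ) (hm : 3 ≤ m) (hn : 1 ≤ n)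
    (A : (Fin m → Fin n) → ℝ)
    (hA : ∀ (σ : Equiv.Perm (Fin m)) (i : Fin m → Fin n), A (i ∘ σ) = A i)
    (b : EuclideanSpace ℝ (Fin n))
    (s : ℕ) (hs1 : 1 ≤ s) (hs2 : s < n)
    (x : EuclideanSpace ℝ (Fin n)) (hx : spars x ≤ s)
    (η : ℝ) (hη : 0 < η)
    (T : Finset (Fin n)) (hT : Tmem (obj m n A b (by omega)) s η x T)
    (m₀ M₀ : ℝ) (hm₀ : 0 < m₀) (hm₀M₀ : m₀ ≤ M₀)
    (hq : ∀ y : EuclideanSpace ℝ (Fin n), (supp y ∪ supp x ∪ T).card ≤ 2 * s →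
      m₀ * ‖y‖ ^ 2 ≤ ∑ i : Fin n, ∑ j : Fin n,
          y i * hess n (obj m n A b (by omega)) x i j * y j ∧
      ∑ i : Fin n, ∑ j : Fin n,
          y i * hess n (obj m n A b (by omega)) x i j * y j ≤ M₀ * ‖y‖ ^ 2)
    (γ : ℝ) (hγ : 0 < γ) (hγm₀ : γ ≤ m₀) (hηM₀ : η ≤ 1 / (4 * M₀))
    (d : EuclideanSpace ℝ (Fin n))
    (hd1 : ∀ i ∈ T, ∑ j ∈ T, hess n (obj m n A b (by omega)) x i j * d j =
      (∑ j ∈ Tᶜ, hess n (obj m n A b (by omega)) x i j * x j)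
        - gradient (obj m n A b (by omega)) x i)
    (hd2 : ∀ j ∉ T, d j = -x j) :
    ∑ i ∈ T, gradient (obj m n A b (by omega)) x i * d i
      ≤ -γ * ‖d‖ ^ 2 + (1 / (4 * η)) * ∑ j ∈ Tᶜ, x j ^ 2 := by
  have hH := hess_symm (contDiff_obj m n A b (by omega)) x
  set H := hess n (obj m n A b (by omega)) x
  set g := gradient (obj m n A b (by omega)) x
  have hcard : (supp x ∪ T).card ≤ 2 * s := by
    have hunion := Finset.card_union_le (supp x) T
    have hTs := hT.1
    unfold spars at hx
    omega
  have hsub : ∀ y : EuclideanSpace ℝ (Fin n), (∀ i, i ∉ T → x i = 0 → y i = 0) →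
      (supp y ∪ supp x ∪ T).card ≤ 2 * s := by
    intro y hy
    refine (Finset.card_le_card fun i hi => ?_).trans hcard
    simp only [supp, Finset.mem_union, Finset.mem_filter, Finset.mem_univ, true_and] at hi ⊢
    have := hy i
    tauto
  have hdsupp : ∀ i, i ∉ T → x i = 0 → d i = 0 := fun i hi hxi => by simp [hd2 i hi, hxi]
  have hqd := (hq d (hsub d hdsupp)).1
  have hqT := (hq (restrict T d) (hsub _ fun i hi _ => by simp [restrict_apply, hi])).1
  have hqTc := (hq (restrict Tᶜ d)
    (hsub _ fun i hi hxi => by simp [restrict_apply, hdsupp i hi hxi])).2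
  have hNewton : ∀ i ∈ T, ∑ j, H i j * d j = -g i := by
    intro i hi
    have hcompl : ∑ j ∈ Tᶜ, H i j * d j = -∑ j ∈ Tᶜ, H i j * x j := by
      rw [← Finset.sum_neg_distrib]
      refine Finset.sum_congr rfl fun j hj => ?_
      rw [hd2 j (Finset.mem_compl.1 hj)]
      ring
    rw [← Finset.sum_add_sum_compl T, hd1 i hi, hcompl]
    ring
  have hpair : ∑ i ∈ T, d i * ∑ j, H i j * d j = -∑ i ∈ T, g i * d i := by
    rw [← Finset.sum_neg_distrib]
    refine Finset.sum_congr rfl fun i hi => ?_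
    rw [hNewton i hi]
    ring
  have hpol := two_mul_sum_restrict hH T d
  rw [hpair] at hpol
  have hcx : ∑ j ∈ Tᶜ, d j ^ 2 = ∑ j ∈ Tᶜ, x j ^ 2 :=
    Finset.sum_congr rfl fun j hj => by rw [hd2 j (Finset.mem_compl.1 hj), neg_sq]
  have hnorm : ‖d‖ ^ 2 = ∑ i ∈ T, d i ^ 2 + ∑ j ∈ Tᶜ, x j ^ 2 := by
    rw [EuclideanSpace.real_norm_sq_eq, ← Finset.sum_add_sum_compl T, hcx]
  rw [norm_restrict_sq] at hqT hqTc
  rw [hcx] at hqTc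
  rw [hnorm] at hqd ⊢
  have hT0 : 0 ≤ ∑ i ∈ T, d i ^ 2 := Finset.sum_nonneg fun i _ => sq_nonneg _
  have hC0 : 0 ≤ ∑ j ∈ Tᶜ, x j ^ 2 := Finset.sum_nonneg fun j _ => sq_nonneg _
  have hM : M₀ ≤ 1 / (4 * η) := by
    have hM₀ : 0 < M₀ := hm₀.trans_le hm₀M₀
    rw [le_div_iff₀ (by positivity)] at hηM₀ ⊢
    linarith
  have hMC := mul_le_mul_of_nonneg_right hM hC0
  have hγT := mul_le_mul_of_nonneg_right hγm₀ hT0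
  have hγC := mul_le_mul_of_nonneg_right hγm₀ hC0
  have hmMC := mul_le_mul_of_nonneg_right hm₀M₀ hC0
  linarith
end
end
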